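/- arXiv:1802.06496 — 6 statements merged into one kernel-verified Lean document; each statement's English description precedes it below -/
import Mathlib

section
/- For every set X₁ ⊆ ℕ, the least fixed point of the monotone operator F : Set ℕ → Set ℕ defined by F(S) = {v : ℕ | (3 ≤ v ∧ v − 2 ∈ S) ∨ (v = 1 ∧ v − 1 ∈ X₁)} equals {v : ℕ | Odd v ∧ 0 ∈ X₁}; that is, the second equation of the PBES E₂ defines X₂(v) iff v is odd and X₁(0) holds. -/
theorem stmt_2 (X₁ : Set ℕ) (F : Set ℕ →o Set ℕ)
    (hF : ∀ S : Set ℕ, F S = {v : ℕ | (3 ≤ v ∧ v - 2 ∈ S) ∨ (v = 1 ∧ v - 1 ∈ X₁)}) :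
    OrderHom.lfp F = {v : ℕ | Odd v ∧ 0 ∈ X₁} := by
  apply le_antisymm
  · apply OrderHom.lfp_le
    rw [hF]
    rintro v (⟨h3, ⟨k, hk⟩, h0⟩ | ⟨rfl, h⟩)
    · exact ⟨⟨k + 1, by omega⟩, h0⟩
    · exact ⟨⟨0, rfl⟩, h⟩
  · rintro v ⟨⟨k, rfl⟩, h0⟩
    induction k with
    | zero =>
      rw [← OrderHom.map_lfp, hF]
      exact Or.inr ⟨rfl, h0⟩
    | succ k ih =>
      rw [← OrderHom.map_lfp, hF]
      refine Or.inl ⟨by omega, ?_⟩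
      have e : 2 * (k + 1) + 1 - 2 = 2 * k + 1 := by omega
      rw [e]
      exact ih
end

section
/- The greatest fixed point of the monotone operator G : Set ℕ → Set ℕ defined by G(S) = {v : ℕ | (v = 0 ∧ v + 2 ∈ S) ∨ (0 < v ∧ Odd (v − 1) ∧ 0 ∈ S ∧ v + 2 ∈ S)} equals the set of even natural numbers {v : ℕ | Even v}; that is, after substituting the solution of X₂ into the first equation of the PBES E₂, the resulting equation defines X₁ as the even numbers. -/
theorem stmt_3 (G : Set ℕ →o Set ℕ)
    (hG : ∀ S : Set ℕ,
      G S = {v : ℕ | (v = 0 ∧ v + 2 ∈ S) ∨ (0 < v ∧ Odd (v - 1) ∧ 0 ∈ S ∧ v + 2 ∈ S)}) :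
    OrderHom.gfp G = {v : ℕ | Even v} := by
  apply le_antisymm
  · intro v hv
    rw [← OrderHom.map_gfp, hG] at hv
    simp only [Set.mem_ofPred_eq, Nat.odd_iff, Nat.even_iff] at hv ⊢
    rcases hv with h | h
    · omega
    · have := h.1
      have := h.2.1
      omega
  · apply OrderHom.le_gfp
    rw [hG]
    intro v hv
    have hv2 : v % 2 = 0 := Nat.even_iff.mp hv
    have h2 : Even (v + 2) := Nat.even_iff.mpr (by omega)
    rcases Nat.eq_zero_or_pos v with h | h
    · exact Or.inl ⟨h, h2⟩
    · exact Or.inr ⟨h, Nat.odd_iff.mpr (by omega), Even.zero, h2⟩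
end

section
/- Let X₁* be the greatest fixed point of G(S) = {v : ℕ | (v = 0 ∧ v + 2 ∈ S) ∨ (0 < v ∧ Odd (v − 1) ∧ 0 ∈ S ∧ v + 2 ∈ S)} and let X₂* be the least fixed point of F(S) = {v : ℕ | (3 ≤ v ∧ v − 2 ∈ S) ∨ (v = 1 ∧ v − 1 ∈ X₁*)}. Then X₁* = {v : ℕ | Even v} and X₂* = {v : ℕ | Odd v}; that is, the solution of the PBES E₂ is X₁ = {0,2,4,…} and X₂ = {1,3,5,…}. -/
theorem stmt_4 (G F : Set ℕ →o Set ℕ)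
    (hG : ∀ S : Set ℕ,
      G S = {v : ℕ | (v = 0 ∧ v + 2 ∈ S) ∨ (0 < v ∧ Odd (v - 1) ∧ 0 ∈ S ∧ v + 2 ∈ S)})
    (hF : ∀ S : Set ℕ,
      F S = {v : ℕ | (3 ≤ v ∧ v - 2 ∈ S) ∨ (v = 1 ∧ v - 1 ∈ OrderHom.gfp G)}) :
    OrderHom.gfp G = {v : ℕ | Even v} ∧ OrderHom.lfp F = {v : ℕ | Odd v} := by
  have h1 : OrderHom.gfp G = {v : ℕ | Even v} := by
    apply le_antisymm
    · intro v hv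
      rw [← OrderHom.map_gfp, hG] at hv
      simp only [Set.mem_ofPred_eq, Nat.even_iff, Nat.odd_iff] at hv ⊢
      omega
    · apply OrderHom.le_gfp
      rw [hG]
      intro v hv
      simp only [Set.mem_ofPred_eq, Nat.even_iff, Nat.odd_iff] at hv ⊢
      rcases Nat.eq_zero_or_pos v with h | h
      · left
        exact ⟨h, by omega⟩
      · right
        exact ⟨h, by omega, by norm_num, by omega⟩
  refine ⟨h1, ?_⟩
  apply le_antisymm
  · apply OrderHom.lfp_le
    rw [hF, h1]
    intro v hv
    simp only [Set.mem_ofPred_eq, Nat.even_iff, Nat.odd_iff] at hv ⊢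
    omega
  · rintro v ⟨k, rfl⟩
    induction k with
    | zero =>
      rw [← OrderHom.map_lfp, hF, h1]
      right
      simp
    | succ k ih =>
      rw [← OrderHom.map_lfp, hF]
      left
      exact ⟨by omega, ih⟩
end

section
/- The greatest fixed point of the monotone operator F : Set ℕ → Set ℕ defined by F(S) = {n : ℕ | ∃ n' : ℕ, Even n ∧ 3*n + 5*n' ∈ S ∧ 4*n + 5*n' ∈ S} equals the set of even natural numbers {n : ℕ | Even n}. In particular 2 belongs to this greatest fixed point, i.e., X₁(2) holds in the existential PBES νX₁(n:N) = ∃n':N. even(n) ∧ X₁(3n+5n') ∧ X₁(4n+5n'). -/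
theorem stmt_5 (F : Set ℕ →o Set ℕ)
    (hF : ∀ S : Set ℕ,
      F S = {n : ℕ | ∃ n' : ℕ, Even n ∧ 3 * n + 5 * n' ∈ S ∧ 4 * n + 5 * n' ∈ S}) :
    OrderHom.gfp F = {n : ℕ | Even n} ∧ 2 ∈ OrderHom.gfp F := by
  have h : OrderHom.gfp F = {n : ℕ | Even n} := by
    apply le_antisymm
    · rw [← OrderHom.map_gfp F, hF]
      rintro n ⟨_, hn, _⟩
      exact hn
    · apply OrderHom.le_gfp
      rw [hF]
      intro n hn
      have hn' : Even n := hn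
      refine ⟨0, hn', ?_, ?_⟩
      · show Even (3 * n + 5 * 0)
        simpa using hn'.mul_left 3
      · show Even (4 * n + 5 * 0)
        simpa using hn'.mul_left 4
  refine ⟨h, ?_⟩
  rw [h]
  exact even_two
end

section
/- The least fixed point of the monotone operator Φ : Set (ℕ × ℕ) → Set (ℕ × ℕ) defined by Φ(M) = {(x, y) | (x > 3 ∧ y + 1 = x) ∨ (∃ e : ℕ, x ≤ 3 ∧ (x + 2, e) ∈ M ∧ (e, y) ∈ M)} equals {(x, y) | (x > 3 ∧ y + 1 = x) ∨ (x ≤ 3 ∧ y = 3)}. That is, the relation M defined by the downsized McCarthy PBES satisfies M(x,y) iff y = F(x), where F(x) = x − 1 for x > 3 and F(x) = 3 for x ≤ 3. -/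
theorem stmt_6 (Φ : Set (ℕ × ℕ) →o Set (ℕ × ℕ))
    (hΦ : ∀ M : Set (ℕ × ℕ),
      Φ M = {p : ℕ × ℕ | (p.1 > 3 ∧ p.2 + 1 = p.1) ∨
        (∃ e : ℕ, p.1 ≤ 3 ∧ (p.1 + 2, e) ∈ M ∧ (e, p.2) ∈ M)}) :
    OrderHom.lfp Φ = {p : ℕ × ℕ | (p.1 > 3 ∧ p.2 + 1 = p.1) ∨ (p.1 ≤ 3 ∧ p.2 = 3)} := by
  apply le_antisymm
  · apply OrderHom.lfp_le
    rw [hΦ]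
    rintro ⟨x, y⟩ h
    simp only [Set.mem_setOf_eq] at h ⊢
    rcases h with h | ⟨e, h1, h2, h3⟩ <;> omega
  · have key : ∀ x y : ℕ, ((x > 3 ∧ y + 1 = x) ∨
        (∃ e : ℕ, x ≤ 3 ∧ (x + 2, e) ∈ OrderHom.lfp Φ ∧ (e, y) ∈ OrderHom.lfp Φ)) →
        (x, y) ∈ OrderHom.lfp Φ := by
      intro x y h
      rw [← OrderHom.map_lfp Φ, hΦ]
      exact h
    have h5 := key 5 4 (Or.inl (by omega))
    have h4 := key 4 3 (Or.inl (by omega))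
    have h3 := key 3 3 (Or.inr ⟨4, by omega, h5, h4⟩)
    have h2 := key 2 3 (Or.inr ⟨3, by omega, h4, h3⟩)
    have h1 := key 1 3 (Or.inr ⟨3, by omega, h3, h3⟩)
    have h0 := key 0 3 (Or.inr ⟨3, by omega, h2, h3⟩)
    rintro ⟨x, y⟩ (h | ⟨hx, hy⟩)
    · exact key x y (Or.inl h)
    · simp only at hx hy
      subst hy
      interval_cases x <;> assumption
end

section
/- For every natural number a, the least fixed point of the monotone operator Φₐ : Set (ℕ × ℕ) → Set (ℕ × ℕ) defined by Φₐ(M) = {(x, y) | (x > a ∧ y + 1 = x) ∨ (∃ e : ℕ, x ≤ a ∧ (x + 2, e) ∈ M ∧ (e, y) ∈ M)} equals {(x, y) | (x > a ∧ y + 1 = x) ∨ (x ≤ a ∧ y = a)}. That is, the function F determined by F(n) = n − 1 if n > a and F(n) = F(F(n+2)) if n ≤ a returns n − 1 for n > a and returns a for n ≤ a. -/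
theorem stmt_7 (a : ℕ) (Φ : Set (ℕ × ℕ) →o Set (ℕ × ℕ))
    (hΦ : ∀ M : Set (ℕ × ℕ),
      Φ M = {p : ℕ × ℕ | (p.1 > a ∧ p.2 + 1 = p.1) ∨
        (∃ e : ℕ, p.1 ≤ a ∧ (p.1 + 2, e) ∈ M ∧ (e, p.2) ∈ M)}) :
    OrderHom.lfp Φ = {p : ℕ × ℕ | (p.1 > a ∧ p.2 + 1 = p.1) ∨ (p.1 ≤ a ∧ p.2 = a)} := by
  have key : ∀ x y : ℕ, (x, y) ∈ OrderHom.lfp Φ ↔ ((x > a ∧ y + 1 = x) ∨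
      (∃ e : ℕ, x ≤ a ∧ (x + 2, e) ∈ OrderHom.lfp Φ ∧ (e, y) ∈ OrderHom.lfp Φ)) := by
    intro x y
    have h := hΦ (OrderHom.lfp Φ)
    rw [OrderHom.map_lfp] at h
    exact Set.ext_iff.mp h (x, y)
  apply le_antisymm
  · apply OrderHom.lfp_le
    rw [hΦ]
    rintro ⟨x, y⟩ h
    simp only [Set.mem_setOf_eq] at h ⊢
    rcases h with h | ⟨e, h1, h2, h3⟩
    · exact Or.inl h
    · omega
  · have big : ∀ y : ℕ, a ≤ y → (y + 1, y) ∈ OrderHom.lfp Φ := fun y hy =>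
      (key _ _).2 (Or.inl ⟨by omega, rfl⟩)
    have ha : (a, a) ∈ OrderHom.lfp Φ :=
      (key _ _).2 (Or.inr ⟨a + 1, le_rfl, big (a + 1) (by omega), big a le_rfl⟩)
    have low : ∀ k x : ℕ, x ≤ a → a - x ≤ k → (x, a) ∈ OrderHom.lfp Φ := by
      intro k
      induction k with
      | zero =>
        intro x h1 h2
        obtain rfl : x = a := by omega
        exact ha
      | succ k ih =>
        intro x h1 h2
        by_cases hx : x = a
        · subst hx
          exact ha
        refine (key _ _).2 (Or.inr ⟨a, h1, ?_, ha⟩)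
        by_cases hx2 : x + 1 = a
        · have h := big a le_rfl
          rwa [show x + 2 = a + 1 by omega]
        · exact ih (x + 2) (by omega) (by omega)
    rintro ⟨x, y⟩ h
    simp only [Set.mem_setOf_eq] at h
    rcases h with ⟨h1, h2⟩ | ⟨h1, h2⟩
    · subst h2
      exact big y (by omega)
    · subst h2
      exact low _ x h1 le_rfl
end
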